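/- arXiv:2003.01080 — 3 statements merged into one kernel-verified Lean document; each statement's English description precedes it below -/
import Mathlib

section
/- Let g be a Hom-Lie superalgebra over a field K of characteristic zero with even bilinear bracket [·,·] and even linear map α, let n ≥ 3, and let φ be an even super-skew-symmetric (n−2)-linear form on g. Define the n-ary product [x₁,…,xₙ]_φ = Σ_{i<j} (−1)^{i+j+1} (−1)^{γ^X_{ij}} φ(x₁,…,x̂ᵢ,…,x̂ⱼ,…,xₙ) [xᵢ,xⱼ] on homogeneous elements, where γ^X_{ij} = (|xᵢ|+|xⱼ|)(|x_{j+1}|+⋯+|xₙ|) + |xᵢ|(|x_{i+1}|+⋯+|x_{j−1}|) and the hats denote omitted arguments. Then [·,…,·]_φ is super-skew-symmetric: for every 1 ≤ i ≤ n−1 and homogeneous x₁,…,xₙ, [x₁,…,xᵢ,x_{i+1},…,xₙ]_φ = −(−1)^{|xᵢ||x_{i+1}|} [x₁,…,x_{i+1},xᵢ,…,xₙ]_φ. -/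
namespace NHomSuper

/-- The sign `(-1)^d` associated to a degree `d : ℤ₂`. -/
def sgn (K : Type*) [Field K] (d : ZMod 2) : K := (-1 : K) ^ d.val

variable {K : Type*} [Field K] [CharZero K]
variable {V : Type*} [AddCommGroup V] [Module K V]

/-- Sum of the degrees of the entries strictly before position `i`:  `|X|^{i-1}`. -/
def partSum {n : ℕ} (d : Fin n → ZMod 2) (i : Fin n) : ZMod 2 :=
  ∑ j ∈ Finset.univ.filter (fun j => j < i), d j

/-- Sum of the degrees of the entries strictly after position `j`. -/
def sumAfter {n : ℕ} (d : Fin n → ZMod 2) (j : Fin n) : ZMod 2 :=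
  ∑ k ∈ Finset.univ.filter (fun k => j < k), d k

/-- Sum of the degrees of the entries strictly between positions `i` and `j`. -/
def sumBetween {n : ℕ} (d : Fin n → ZMod 2) (i j : Fin n) : ZMod 2 :=
  ∑ k ∈ Finset.univ.filter (fun k => i < k ∧ k < j), d k

/-- The exponent `γ^X_{ij} = (|x_i|+|x_j|)(|x_{j+1}|+⋯+|x_n|) + |x_i|(|x_{i+1}|+⋯+|x_{j-1}|)`. -/
def gamma {n : ℕ} (d : Fin n → ZMod 2) (i j : Fin n) : ZMod 2 :=
  (d i + d j) * sumAfter d j + d i * sumBetween d i j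

/-- The increasing embedding `Fin (m+1) → Fin (m+3)` omitting the two positions `i < j`. -/
def skip2 {m : ℕ} (i j : Fin (m + 3)) (k : Fin (m + 1)) : Fin (m + 3) :=
  if h1 : (k : ℕ) < (i : ℕ) then ⟨(k : ℕ), lt_trans h1 i.isLt⟩
  else if h2 : (k : ℕ) + 1 < (j : ℕ) then ⟨(k : ℕ) + 1, lt_trans h2 j.isLt⟩
  else ⟨(k : ℕ) + 2, by have hk := k.isLt; omega⟩

/-- A Hom-Lie superalgebra structure on the ℤ₂-graded vector space `V` with grading `gr`. -/
structure IsHomLieSuper (gr : ZMod 2 → Submodule K V)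
    (br : V →ₗ[K] V →ₗ[K] V) (α : Module.End K V) : Prop where
  internal : DirectSum.IsInternal gr
  alpha_even : ∀ (a : ZMod 2) (x : V), x ∈ gr a → α x ∈ gr a
  br_even : ∀ (a b : ZMod 2) (x y : V), x ∈ gr a → y ∈ gr b → br x y ∈ gr (a + b)
  skew : ∀ (a b : ZMod 2) (x y : V), x ∈ gr a → y ∈ gr b →
    br x y = - sgn K (a * b) • br y x
  jacobi : ∀ (a b c : ZMod 2) (x y z : V), x ∈ gr a → y ∈ gr b → z ∈ gr c →
    sgn K (a * c) • br (α x) (br y z) + sgn K (b * a) • br (α y) (br z x)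
      + sgn K (c * b) • br (α z) (br x y) = 0

/-- An even multilinear form: it vanishes on homogeneous tuples of nonzero total degree. -/
def FormEven (gr : ZMod 2 → Submodule K V) {p : ℕ}
    (φ : MultilinearMap K (fun _ : Fin p => V) K) : Prop :=
  ∀ (d : Fin p → ZMod 2) (x : Fin p → V), (∀ i, x i ∈ gr (d i)) →
    (∑ i, d i) ≠ 0 → φ x = 0

/-- A super-skew-symmetric multilinear form (adjacent transpositions). -/
def FormSuperSkew (gr : ZMod 2 → Submodule K V) {p : ℕ}
    (φ : MultilinearMap K (fun _ : Fin p => V) K) : Prop :=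
  ∀ (d : Fin p → ZMod 2) (x : Fin p → V), (∀ i, x i ∈ gr (d i)) →
    ∀ i j : Fin p, (j : ℕ) = (i : ℕ) + 1 →
      φ x = - sgn K (d i * d j) * φ (x ∘ Equiv.swap i j)

/-- The `n`-ary product `[x₁,…,xₙ]_φ` (here `n = m+3`) induced by a binary bracket `br`
and an `(n-2)`-cochain `φ`, for a homogeneous tuple `x` with degrees `d`. -/
def phiBr {m : ℕ} (br : V →ₗ[K] V →ₗ[K] V)
    (φ : MultilinearMap K (fun _ : Fin (m + 1) => V) K)
    (d : Fin (m + 3) → ZMod 2) (x : Fin (m + 3) → V) : V :=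
  ∑ p ∈ Finset.univ.filter (fun p : Fin (m + 3) × Fin (m + 3) => p.1 < p.2),
    ((-1 : K) ^ ((p.1 : ℕ) + (p.2 : ℕ) + 1) * sgn K (gamma d p.1 p.2)
      * φ (x ∘ skip2 p.1 p.2)) • br (x p.1) (x p.2)

/-- Condition `φ ∧ δφ_X = 0` of Theorem 2.9. -/
def PhiCond1 {m : ℕ} (gr : ZMod 2 → Submodule K V) (br : V →ₗ[K] V →ₗ[K] V)
    (φ : MultilinearMap K (fun _ : Fin (m + 1) => V) K) : Prop :=
  ∀ (dx : Fin m → ZMod 2) (x : Fin m → V) (dy : Fin (m + 3) → ZMod 2)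
      (y : Fin (m + 3) → V),
    (∀ i, x i ∈ gr (dx i)) → (∀ i, y i ∈ gr (dy i)) →
    ∑ p ∈ Finset.univ.filter (fun p : Fin (m + 3) × Fin (m + 3) => p.1 < p.2),
      (-1 : K) ^ ((p.1 : ℕ) + (p.2 : ℕ)) * sgn K (gamma dy p.1 p.2)
        * φ (y ∘ skip2 p.1 p.2) * φ (Fin.snoc x (br (y p.1) (y p.2))) = 0

/-- Condition `φ ∘ (α ⊗ Id ⊗ ⋯ ⊗ Id) = φ`. -/
def PhiCond2 {m : ℕ} (φ : MultilinearMap K (fun _ : Fin (m + 1) => V) K)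
    (α : Module.End K V) : Prop :=
  ∀ x : Fin (m + 1) → V, φ (Function.update x 0 (α (x 0))) = φ x

/-- A multiplicative `n`-Hom-Lie superalgebra structure (`n = m+3`) given by a
degree-parametrized `n`-linear bracket `B` on homogeneous tuples. -/
structure IsMultNHomLieSuperGr {m : ℕ} (gr : ZMod 2 → Submodule K V)
    (B : (Fin (m + 3) → ZMod 2) → (Fin (m + 3) → V) → V) (α : Module.End K V) : Prop where
  internal : DirectSum.IsInternal gr
  alpha_even : ∀ (a : ZMod 2) (x : V), x ∈ gr a → α x ∈ gr a
  map_add : ∀ (d : Fin (m + 3) → ZMod 2) (x : Fin (m + 3) → V) (i : Fin (m + 3)) (u v : V),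
    B d (Function.update x i (u + v)) = B d (Function.update x i u) + B d (Function.update x i v)
  map_smul : ∀ (d : Fin (m + 3) → ZMod 2) (x : Fin (m + 3) → V) (i : Fin (m + 3)) (c : K) (u : V),
    B d (Function.update x i (c • u)) = c • B d (Function.update x i u)
  even : ∀ (d : Fin (m + 3) → ZMod 2) (x : Fin (m + 3) → V), (∀ i, x i ∈ gr (d i)) →
    B d x ∈ gr (∑ i, d i)
  skew : ∀ (d : Fin (m + 3) → ZMod 2) (x : Fin (m + 3) → V), (∀ i, x i ∈ gr (d i)) →
    ∀ i j : Fin (m + 3), (j : ℕ) = (i : ℕ) + 1 →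
      B d x = - sgn K (d i * d j) • B (d ∘ Equiv.swap i j) (x ∘ Equiv.swap i j)
  mult : ∀ (d : Fin (m + 3) → ZMod 2) (x : Fin (m + 3) → V), (∀ i, x i ∈ gr (d i)) →
    α (B d x) = B d (fun i => α (x i))
  nambu : ∀ (dx : Fin (m + 2) → ZMod 2) (x : Fin (m + 2) → V)
      (dy : Fin (m + 3) → ZMod 2) (y : Fin (m + 3) → V),
      (∀ i, x i ∈ gr (dx i)) → (∀ i, y i ∈ gr (dy i)) →
    B (Fin.snoc dx (∑ i, dy i)) (Fin.snoc (fun i => α (x i)) (B dy y)) =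
      ∑ i : Fin (m + 3), sgn K ((∑ k, dx k) * partSum dy i) •
        B (Function.update dy i ((∑ k, dx k) + dy i))
          (Function.update (fun j => α (y j)) i (B (Fin.snoc dx (dy i)) (Fin.snoc x (y i))))

/-- An `n`-ary Hom-Nambu superalgebra structure (`n = p+2`) with (degree-free) bracket `nbr`. -/
structure IsNaryHomNambuSuper {p : ℕ} (gr : ZMod 2 → Submodule K V)
    (nbr : (Fin (p + 2) → V) → V) (β : Module.End K V) : Prop where
  internal : DirectSum.IsInternal gr
  alpha_even : ∀ (a : ZMod 2) (x : V), x ∈ gr a → β x ∈ gr a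
  map_add : ∀ (x : Fin (p + 2) → V) (i : Fin (p + 2)) (u v : V),
    nbr (Function.update x i (u + v)) = nbr (Function.update x i u) + nbr (Function.update x i v)
  map_smul : ∀ (x : Fin (p + 2) → V) (i : Fin (p + 2)) (c : K) (u : V),
    nbr (Function.update x i (c • u)) = c • nbr (Function.update x i u)
  even : ∀ (d : Fin (p + 2) → ZMod 2) (x : Fin (p + 2) → V), (∀ i, x i ∈ gr (d i)) →
    nbr x ∈ gr (∑ i, d i)
  nambu : ∀ (dx : Fin (p + 1) → ZMod 2) (x : Fin (p + 1) → V)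
      (dy : Fin (p + 2) → ZMod 2) (y : Fin (p + 2) → V),
      (∀ i, x i ∈ gr (dx i)) → (∀ i, y i ∈ gr (dy i)) →
    nbr (Fin.snoc (fun i => β (x i)) (nbr y)) =
      ∑ i : Fin (p + 2), sgn K ((∑ k, dx k) * partSum dy i) •
        nbr (Function.update (fun j => β (y j)) i (nbr (Fin.snoc x (y i))))

/-- A multiplicative `n`-ary Hom-Nambu superalgebra (`n = p+2`). -/
structure IsMultNaryHomNambuSuper {p : ℕ} (gr : ZMod 2 → Submodule K V)
    (nbr : (Fin (p + 2) → V) → V) (β : Module.End K V)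
    extends IsNaryHomNambuSuper gr nbr β : Prop where
  mult : ∀ x : Fin (p + 2) → V, β (nbr x) = nbr fun i => β (x i)

/-- The `n`-ary bracket (`n = p+2`) induced by a binary Hom-Lie superalgebra bracket:
`[x₁,…,xₙ]ₙ = [[…[[x₁,x₂],α(x₃)],…],α^{n-2}(xₙ)]`. -/
def nBr (br : V →ₗ[K] V →ₗ[K] V) (α : Module.End K V) : (p : ℕ) → (Fin (p + 2) → V) → V
  | 0, x => br (x 0) (x 1)
  | p + 1, x => br (nBr br α p (Fin.init x)) ((α ^ (p + 1)) (x (Fin.last (p + 2))))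

/-- A homogeneous `α^k`-derivation of degree `dD` of a binary Hom-superalgebra. -/
def IsAlphaKDeriv2 (gr : ZMod 2 → Submodule K V) (br : V →ₗ[K] V →ₗ[K] V)
    (α : Module.End K V) (k : ℕ) (dD : ZMod 2) (D : Module.End K V) : Prop :=
  D * α = α * D ∧ (∀ (a : ZMod 2) (x : V), x ∈ gr a → D x ∈ gr (a + dD)) ∧
  ∀ (a b : ZMod 2) (x y : V), x ∈ gr a → y ∈ gr b →
    D (br x y) = br (D x) ((α ^ k) y) + sgn K (dD * a) • br ((α ^ k) x) (D y)

/-- A homogeneous `α^k`-derivation of degree `dD` of an `n`-ary Hom-superalgebra (`n = p+2`). -/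
def IsNaryAlphaKDeriv {p : ℕ} (gr : ZMod 2 → Submodule K V)
    (nbr : (Fin (p + 2) → V) → V) (α : Module.End K V) (k : ℕ) (dD : ZMod 2)
    (D : Module.End K V) : Prop :=
  D * α = α * D ∧ (∀ (a : ZMod 2) (x : V), x ∈ gr a → D x ∈ gr (a + dD)) ∧
  ∀ (dy : Fin (p + 2) → ZMod 2) (y : Fin (p + 2) → V), (∀ i, y i ∈ gr (dy i)) →
    D (nbr y) = ∑ i : Fin (p + 2), sgn K (dD * partSum dy i) •
      nbr (Function.update (fun j => (α ^ k) (y j)) i (D (y i)))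

/-- Rota-Baxter operator of weight `0` on a binary Hom-superalgebra. -/
def IsRotaBaxter2 (gr : ZMod 2 → Submodule K V) (br : V →ₗ[K] V →ₗ[K] V)
    (α : Module.End K V) (R : Module.End K V) : Prop :=
  (∀ (a : ZMod 2) (x : V), x ∈ gr a → R x ∈ gr a) ∧ R * α = α * R ∧
  ∀ x y : V, br (R x) (R y) = R (br (R x) y + br x (R y))

/-- The `3`-supercommutator of a ternary product, on homogeneous elements of degrees `a,b,c`. -/
def cbr (T : V → V → V → V) (a b c : ZMod 2) (x y z : V) : V :=
  T x y z + sgn K (a * (b + c)) • T y z x + sgn K (c * (a + b)) • T z x y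

/-- A `3`-Hom-Lie superalgebra structure. -/
structure Is3HomLieSuper (gr : ZMod 2 → Submodule K V)
    (br : V →ₗ[K] V →ₗ[K] V →ₗ[K] V) (α : Module.End K V) : Prop where
  internal : DirectSum.IsInternal gr
  alpha_even : ∀ (a : ZMod 2) (x : V), x ∈ gr a → α x ∈ gr a
  even : ∀ (a b c : ZMod 2) (x y z : V), x ∈ gr a → y ∈ gr b → z ∈ gr c →
    br x y z ∈ gr (a + b + c)
  skew12 : ∀ (a b c : ZMod 2) (x y z : V), x ∈ gr a → y ∈ gr b → z ∈ gr c →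
    br x y z = - sgn K (a * b) • br y x z
  skew23 : ∀ (a b c : ZMod 2) (x y z : V), x ∈ gr a → y ∈ gr b → z ∈ gr c →
    br x y z = - sgn K (b * c) • br x z y
  nambu : ∀ (a₁ a₂ b₁ b₂ b₃ : ZMod 2) (x₁ x₂ y₁ y₂ y₃ : V),
    x₁ ∈ gr a₁ → x₂ ∈ gr a₂ → y₁ ∈ gr b₁ → y₂ ∈ gr b₂ → y₃ ∈ gr b₃ →
    br (α x₁) (α x₂) (br y₁ y₂ y₃) =
      br (br x₁ x₂ y₁) (α y₂) (α y₃)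
      + sgn K ((a₁ + a₂) * b₁) • br (α y₁) (br x₁ x₂ y₂) (α y₃)
      + sgn K ((a₁ + a₂) * (b₁ + b₂)) • br (α y₁) (α y₂) (br x₁ x₂ y₃)

/-- A `3`-Hom-pre-Lie superalgebra structure. -/
structure Is3HomPreLieSuper (gr : ZMod 2 → Submodule K V)
    (T : V →ₗ[K] V →ₗ[K] V →ₗ[K] V) (α : Module.End K V) : Prop where
  internal : DirectSum.IsInternal gr
  alpha_even : ∀ (a : ZMod 2) (x : V), x ∈ gr a → α x ∈ gr a
  even : ∀ (a b c : ZMod 2) (x y z : V), x ∈ gr a → y ∈ gr b → z ∈ gr c →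
    T x y z ∈ gr (a + b + c)
  skew12 : ∀ (a b c : ZMod 2) (x y z : V), x ∈ gr a → y ∈ gr b → z ∈ gr c →
    T x y z = - sgn K (a * b) • T y x z
  ax2 : ∀ (a₁ a₂ a₃ a₄ a₅ : ZMod 2) (x₁ x₂ x₃ x₄ x₅ : V),
    x₁ ∈ gr a₁ → x₂ ∈ gr a₂ → x₃ ∈ gr a₃ → x₄ ∈ gr a₄ → x₅ ∈ gr a₅ →
    T (α x₁) (α x₂) (T x₃ x₄ x₅) =
      T (cbr (K := K) (fun u v w => T u v w) a₁ a₂ a₃ x₁ x₂ x₃) (α x₄) (α x₅)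
      + sgn K (a₃ * (a₁ + a₂)) •
          T (α x₃) (cbr (K := K) (fun u v w => T u v w) a₁ a₂ a₄ x₁ x₂ x₄) (α x₅)
      + sgn K ((a₁ + a₂) * (a₃ + a₄)) • T (α x₃) (α x₄) (T x₁ x₂ x₅)
  ax3 : ∀ (a₁ a₂ a₃ a₄ a₅ : ZMod 2) (x₁ x₂ x₃ x₄ x₅ : V),
    x₁ ∈ gr a₁ → x₂ ∈ gr a₂ → x₃ ∈ gr a₃ → x₄ ∈ gr a₄ → x₅ ∈ gr a₅ →
    T (cbr (K := K) (fun u v w => T u v w) a₁ a₂ a₃ x₁ x₂ x₃) (α x₄) (α x₅) =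
      T (α x₁) (α x₂) (T x₃ x₄ x₅)
      + sgn K (a₁ * (a₂ + a₃)) • T (α x₂) (α x₃) (T x₁ x₄ x₅)
      + sgn K (a₃ * (a₁ + a₂)) • T (α x₃) (α x₁) (T x₂ x₄ x₅)

/-- Rota-Baxter operator of weight `0` on a `3`-Hom-Lie superalgebra. -/
def IsRotaBaxter3 (gr : ZMod 2 → Submodule K V)
    (br : V →ₗ[K] V →ₗ[K] V →ₗ[K] V) (α : Module.End K V) (R : Module.End K V) : Prop :=
  (∀ (a : ZMod 2) (x : V), x ∈ gr a → R x ∈ gr a) ∧ R * α = α * R ∧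
  ∀ x y z : V, br (R x) (R y) (R z) =
    R (br (R x) (R y) z + br (R x) y (R z) + br x (R y) (R z))

lemma sgn_add (a b : ZMod 2) : sgn K (a + b) = sgn K a * sgn K b := by
  simp only [sgn]
  rw [ZMod.val_add, ← neg_one_pow_eq_pow_mod_two, pow_add]

lemma sgn_mul_self (a : ZMod 2) : sgn K a * sgn K a = 1 := by
  rw [← sgn_add, CharTwo.add_self_eq_zero]; simp [sgn]

section Signs

variable {n : ℕ} (d : Fin n → ZMod 2) {i j : Fin n}

lemma sumAfter_comp_swap (hij : (j : ℕ) = i + 1) (b : Fin n) :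
    sumAfter (d ∘ Equiv.swap i j) (Equiv.swap i j b) =
      sumAfter d b + (if b = i then d j else 0) + (if b = j then d i else 0) := by
  have hi : (if b = j then d i else 0) = ∑ k, if k = i ∧ b = j then d k else 0 := by
    split_ifs with h <;> simp [h]
  have hj : (if b = i then d j else 0) = ∑ k, if k = j ∧ b = i then d k else 0 := by
    split_ifs with h <;> simp [h]
  rw [hi, hj]
  simp only [sumAfter, Finset.sum_filter]
  rw [← Equiv.sum_comp (Equiv.swap i j), ← Finset.sum_add_distrib, ← Finset.sum_add_distrib]
  refine Finset.sum_congr rfl fun k _ => ?_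
  have h2 := CharTwo.add_self_eq_zero (d k)
  simp only [Function.comp_apply, Equiv.swap_apply_self]
  simp only [Equiv.swap_apply_def, Fin.lt_def, Fin.ext_iff]
  grind

lemma sumBetween_comp_swap (hij : (j : ℕ) = i + 1) {a b : Fin n} (hab : a < b)
    (hne : ¬(a = i ∧ b = j)) :
    sumBetween (d ∘ Equiv.swap i j) (Equiv.swap i j a) (Equiv.swap i j b) =
      sumBetween d a b + (if a = i ∨ b = i then d j else 0) +
        (if a = j ∨ b = j then d i else 0) := by
  have hi : (if a = j ∨ b = j then d i else 0) =
      ∑ k, if k = i ∧ (a = j ∨ b = j) then d k else 0 := by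
    split_ifs with h <;> simp [h]
  have hj : (if a = i ∨ b = i then d j else 0) =
      ∑ k, if k = j ∧ (a = i ∨ b = i) then d k else 0 := by
    split_ifs with h <;> simp [h]
  rw [hi, hj]
  simp only [sumBetween, Finset.sum_filter]
  rw [← Equiv.sum_comp (Equiv.swap i j), ← Finset.sum_add_distrib, ← Finset.sum_add_distrib]
  refine Finset.sum_congr rfl fun k _ => ?_
  have h2 := CharTwo.add_self_eq_zero (d k)
  simp only [Function.comp_apply, Equiv.swap_apply_self]
  simp only [Equiv.swap_apply_def, Fin.lt_def, Fin.ext_iff] at *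
  grind

lemma gamma_comp_swap (hij : (j : ℕ) = i + 1) {a b : Fin n} (hab : a < b)
    (hne : ¬(a = i ∧ b = j)) :
    gamma (d ∘ Equiv.swap i j) (Equiv.swap i j a) (Equiv.swap i j b) =
      gamma d a b + if a = i ∨ a = j ∨ b = i ∨ b = j then d i * d j else 0 := by
  have hji : i ≠ j := by rintro rfl; omega
  have h0 : (2 : ZMod 2) = 0 := rfl
  simp only [gamma, sumAfter_comp_swap d hij, sumBetween_comp_swap d hij hab hne,
    Function.comp_apply, Equiv.swap_apply_self]
  have hlt : (a : ℕ) < b := hab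
  by_cases h1 : a = i
  · subst h1
    have h2 : b ≠ a := by rintro rfl; omega
    have h3 : b ≠ j := fun h => hne ⟨rfl, h⟩
    simp [h2, h3, hji]
    ring
  by_cases h2 : a = j
  · subst h2
    have h3 : b ≠ a := by rintro rfl; omega
    have h4 : b ≠ i := by rintro rfl; omega
    simp [h3, h4, h1]
    ring
  by_cases h3 : b = i
  · subst h3
    simp [h1, h2, hji]
    linear_combination d a * d j * h0
  by_cases h4 : b = j
  · subst h4
    simp [h1, h2, h3]
    linear_combination d a * d i * h0
  simp [h1, h2, h3, h4]

/-- The sign of `(-1)^(a+b)` changes when exactly one of `a`, `b` is moved by the swap. -/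
lemma neg_one_pow_swap (hij : (j : ℕ) = i + 1) {a b : Fin n} (hab : a < b)
    (hne : ¬(a = i ∧ b = j)) (h : a = i ∨ a = j ∨ b = i ∨ b = j) :
    (-1 : K) ^ ((Equiv.swap i j a : ℕ) + (Equiv.swap i j b : ℕ) + 1) =
      -(-1 : K) ^ ((a : ℕ) + (b : ℕ) + 1) := by
  have key : (Equiv.swap i j a : ℕ) + (Equiv.swap i j b : ℕ) + 1 = (a : ℕ) + b + 1 + 1 ∨
      (a : ℕ) + b + 1 = (Equiv.swap i j a : ℕ) + (Equiv.swap i j b : ℕ) + 1 + 1 := by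
    simp only [Equiv.swap_apply_def, Fin.lt_def, Fin.ext_iff] at *
    grind
  rcases key with h | h <;> rw [h, pow_succ _ (_ + 1)] <;> ring

end Signs

section Skip

variable {m : ℕ} {i j a b : Fin (m + 3)}

lemma skip2_injective : Function.Injective (skip2 a b) := by
  intro k l h
  simp only [skip2, Fin.ext_iff] at *
  split_ifs at h <;> simp at h <;> omega

lemma skip2_ne_left (k : Fin (m + 1)) : skip2 a b k ≠ a := by
  intro h
  simp only [skip2, Fin.ext_iff] at *
  split_ifs at h <;> simp at h <;> omega

lemma skip2_ne_right (hab : a < b) (k : Fin (m + 1)) : skip2 a b k ≠ b := by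
  intro h
  simp only [skip2, Fin.lt_def, Fin.ext_iff] at *
  split_ifs at h <;> simp at h <;> omega

lemma swap_comp_skip2_swap (hij : (j : ℕ) = i + 1) (hab : a < b)
    (hne : ¬(a = i ∧ b = j)) (h : a = i ∨ a = j ∨ b = i ∨ b = j) :
    Equiv.swap i j ∘ skip2 (Equiv.swap i j a) (Equiv.swap i j b) = skip2 a b := by
  funext k
  have hk := k.isLt
  simp only [Function.comp_apply, Equiv.swap_apply_def, skip2, Fin.lt_def, Fin.ext_iff] at *
  grind

lemma exists_skip2_eq_adjacent (hij : (j : ℕ) = i + 1) (hab : a < b)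
    (hai : a ≠ i) (haj : a ≠ j) (hbi : b ≠ i) (hbj : b ≠ j) :
    ∃ k l : Fin (m + 1), (l : ℕ) = k + 1 ∧ skip2 a b k = i ∧ skip2 a b l = j := by
  have hj := j.isLt
  have hb := b.isLt
  simp only [skip2, Fin.lt_def, Fin.ext_iff, ne_eq] at *
  rcases lt_or_gt_of_ne hai with h1 | h1
  · rcases lt_or_gt_of_ne hbi with h2 | h2
    · refine ⟨⟨i - 2, by omega⟩, ⟨i - 1, by omega⟩, ?_, ?_, ?_⟩ <;> grind
    · refine ⟨⟨i - 1, by omega⟩, ⟨i, by omega⟩, ?_, ?_, ?_⟩ <;> grind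
  · refine ⟨⟨i, by omega⟩, ⟨i + 1, by omega⟩, ?_, ?_, ?_⟩ <;> grind

end Skip

section Summands

variable {m : ℕ} {gr : ZMod 2 → Submodule K V}

/-- The summand of `phiBr` at the pair `p`. -/
def phiBrTerm (br : V →ₗ[K] V →ₗ[K] V) (φ : MultilinearMap K (fun _ : Fin (m + 1) => V) K)
    (d : Fin (m + 3) → ZMod 2) (x : Fin (m + 3) → V) (p : Fin (m + 3) × Fin (m + 3)) : V :=
  ((-1 : K) ^ ((p.1 : ℕ) + (p.2 : ℕ) + 1) * sgn K (gamma d p.1 p.2)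
    * φ (x ∘ skip2 p.1 p.2)) • br (x p.1) (x p.2)

variable {br : V →ₗ[K] V →ₗ[K] V} {φ : MultilinearMap K (fun _ : Fin (m + 1) => V) K}
  {d : Fin (m + 3) → ZMod 2} {x : Fin (m + 3) → V} {i j : Fin (m + 3)}

lemma phiBrTerm_self
    (hbr : ∀ (a b : ZMod 2) (u v : V), u ∈ gr a → v ∈ gr b →
      br u v = - sgn K (a * b) • br v u)
    (hx : ∀ k, x k ∈ gr (d k)) (hij : (j : ℕ) = i + 1) :
    phiBrTerm br φ d x (i, j) = - sgn K (d i * d j) •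
      phiBrTerm br φ (d ∘ Equiv.swap i j) (x ∘ Equiv.swap i j) (i, j) := by
  have hlt : i < j := by simp [Fin.lt_def, hij]
  have hfix : ∀ k, k ≠ i → k ≠ j → Equiv.swap i j k = k :=
    fun k => Equiv.swap_apply_of_ne_of_ne
  have hskip : (x ∘ Equiv.swap i j) ∘ skip2 i j = x ∘ skip2 i j := by
    funext k
    simp [hfix _ (skip2_ne_left k) (skip2_ne_right hlt k)]
  have hafter : sumAfter (d ∘ Equiv.swap i j) j = sumAfter d j := by
    refine Finset.sum_congr rfl fun k hk => ?_
    have hk : j < k := by simpa using hk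
    simp [hfix k (hlt.trans hk).ne' hk.ne']
  have hbetween (e : Fin (m + 3) → ZMod 2) : sumBetween e i j = 0 := by
    refine Finset.sum_eq_zero fun k hk => ?_
    simp only [Finset.mem_filter, Finset.mem_univ, true_and, Fin.lt_def] at hk
    omega
  have hgamma : gamma (d ∘ Equiv.swap i j) i j = gamma d i j := by
    simp [gamma, hafter, hbetween, add_comm]
  simp only [phiBrTerm, hskip, hgamma]
  simp only [Function.comp_apply, Equiv.swap_apply_left, Equiv.swap_apply_right]
  rw [hbr _ _ _ _ (hx i) (hx j), smul_smul, smul_smul]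
  congr 1
  ring

lemma phiBrTerm_swap (hφ : FormSuperSkew gr φ) (hx : ∀ k, x k ∈ gr (d k))
    (hij : (j : ℕ) = i + 1) {a b : Fin (m + 3)} (hab : a < b) (hne : ¬(a = i ∧ b = j)) :
    phiBrTerm br φ d x (a, b) = - sgn K (d i * d j) •
      phiBrTerm br φ (d ∘ Equiv.swap i j) (x ∘ Equiv.swap i j)
        (Equiv.swap i j a, Equiv.swap i j b) := by
  simp only [phiBrTerm, gamma_comp_swap d hij hab hne, Function.comp_apply,
    Equiv.swap_apply_self, smul_smul, Function.comp_assoc]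
  congr 1
  by_cases h : a = i ∨ a = j ∨ b = i ∨ b = j
  · rw [neg_one_pow_swap hij hab hne h, swap_comp_skip2_swap hij hab hne h, if_pos h, sgn_add]
    linear_combination (-(-1 : K) ^ ((a : ℕ) + b + 1) * sgn K (gamma d a b) *
      φ (x ∘ skip2 a b)) * sgn_mul_self (K := K) (d i * d j)
  · rw [if_neg h]
    push Not at h
    obtain ⟨hai, haj, hbi, hbj⟩ := h
    obtain ⟨k, l, hkl, rfl, rfl⟩ := exists_skip2_eq_adjacent hij hab hai haj hbi hbj
    rw [Equiv.swap_apply_of_ne_of_ne hai haj, Equiv.swap_apply_of_ne_of_ne hbi hbj,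
      skip2_injective.swap_comp,
      hφ (d ∘ skip2 a b) (x ∘ skip2 a b) (fun _ => hx _) k l hkl]
    simp only [Function.comp_apply, Function.comp_assoc, add_zero]
    ring

end Summands

theorem stmt0 (m : ℕ) (gr : ZMod 2 → Submodule K V) (br : V →ₗ[K] V →ₗ[K] V)
    (α : Module.End K V) (hg : IsHomLieSuper gr br α)
    (φ : MultilinearMap K (fun _ : Fin (m + 1) => V) K)
    (hφe : FormEven gr φ) (hφs : FormSuperSkew gr φ)
    (d : Fin (m + 3) → ZMod 2) (x : Fin (m + 3) → V) (hx : ∀ i, x i ∈ gr (d i))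
    (i j : Fin (m + 3)) (hij : (j : ℕ) = (i : ℕ) + 1) :
    phiBr br φ d x =
      - sgn K (d i * d j) • phiBr br φ (d ∘ Equiv.swap i j) (x ∘ Equiv.swap i j) := by
  change ∑ p ∈ Finset.univ.filter (fun p : Fin (m + 3) × Fin (m + 3) => p.1 < p.2),
      phiBrTerm br φ d x p = - sgn K (d i * d j) •
    ∑ p ∈ Finset.univ.filter (fun p : Fin (m + 3) × Fin (m + 3) => p.1 < p.2),
      phiBrTerm br φ (d ∘ Equiv.swap i j) (x ∘ Equiv.swap i j) p
  rw [Finset.smul_sum]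
  let e (p : Fin (m + 3) × Fin (m + 3)) : Fin (m + 3) × Fin (m + 3) :=
    if p.1 = i ∧ p.2 = j then p else (Equiv.swap i j p.1, Equiv.swap i j p.2)
  have he : ∀ p : Fin (m + 3) × Fin (m + 3), p.1 < p.2 → (e p).1 < (e p).2 ∧ e (e p) = p := by
    rintro ⟨a, b⟩ hab
    by_cases h : a = i ∧ b = j
    · simp [e, h, Fin.lt_def, hij]
    · have h' : ¬(Equiv.swap i j a = i ∧ Equiv.swap i j b = j) := by
        simp only [Equiv.swap_apply_eq_iff, Equiv.swap_apply_left, Equiv.swap_apply_right]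
        rintro ⟨rfl, rfl⟩
        simp only [Fin.lt_def] at hab
        omega
      simp only [e, if_neg h, if_neg h', Equiv.swap_apply_self, and_true]
      simp only [Equiv.swap_apply_def, Fin.lt_def, Fin.ext_iff] at *
      grind
  refine Finset.sum_nbij' e e ?_ ?_ ?_ ?_ ?_ <;>
    simp only [Finset.mem_filter, Finset.mem_univ, true_and]
  · exact fun p hp => (he p hp).1
  · exact fun p hp => (he p hp).1
  · exact fun p hp => (he p hp).2
  · exact fun p hp => (he p hp).2
  · rintro ⟨a, b⟩ hab
    by_cases h : a = i ∧ b = j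
    · obtain ⟨rfl, rfl⟩ := h
      simpa [e] using phiBrTerm_self hg.skew hx hij
    · simpa only [e, if_neg h] using phiBrTerm_swap hφs hx hij hab h

end NHomSuper
end

section
/- Let (N,[·,…,·],α) be a multiplicative n-ary Hom-Nambu superalgebra over a field K of characteristic zero, let k ≥ 1, and let X = (x₁,…,x_{n−1}) be a tuple of homogeneous elements satisfying α(xᵢ) = xᵢ for all i. Define ad^k_X : N → N by ad^k_X(y) = [x₁,…,x_{n−1},α^k(y)]. Then ad^k_X is an α^{k+1}-derivation of N of degree |X| = |x₁|+⋯+|x_{n−1}|, i.e. ad^k_X ∘ α = α ∘ ad^k_X and ad^k_X([y₁,…,yₙ]) = Σ_{i=1}^{n} (−1)^{|X||Y|^{i−1}} [α^{k+1}(y₁),…,ad^k_X(yᵢ),…,α^{k+1}(yₙ)] for all homogeneous y₁,…,yₙ. -/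
namespace NHomSuper

variable {K : Type*} [Field K] [CharZero K]
variable {V : Type*} [AddCommGroup V] [Module K V]

theorem IsMultNaryHomNambuSuper.pow_nbr {p : ℕ} {gr : ZMod 2 → Submodule K V}
    {nbr : (Fin (p + 2) → V) → V} {α : Module.End K V}
    (hN : IsMultNaryHomNambuSuper gr nbr α) (k : ℕ) (y : Fin (p + 2) → V) :
    (α ^ k) (nbr y) = nbr fun i => (α ^ k) (y i) := by
  induction k with
  | zero => simp
  | succ k ih => simp only [pow_succ', Module.End.mul_apply, ih, hN.mult]

theorem IsNaryHomNambuSuper.pow_mem {p : ℕ} {gr : ZMod 2 → Submodule K V}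
    {nbr : (Fin (p + 2) → V) → V} {α : Module.End K V}
    (hN : IsNaryHomNambuSuper gr nbr α) (k : ℕ) {a : ZMod 2} {y : V} (hy : y ∈ gr a) :
    (α ^ k) y ∈ gr a := by
  induction k with
  | zero => simpa using hy
  | succ k ih =>
    rw [pow_succ', Module.End.mul_apply]
    exact hN.alpha_even a _ ih

theorem stmt5 (p k : ℕ) (hk : 1 ≤ k) (gr : ZMod 2 → Submodule K V)
    (nbr : (Fin (p + 2) → V) → V) (α : Module.End K V)
    (hN : IsMultNaryHomNambuSuper gr nbr α)
    (dx : Fin (p + 1) → ZMod 2) (x : Fin (p + 1) → V) (hx : ∀ i, x i ∈ gr (dx i))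
    (hfix : ∀ i, α (x i) = x i) :
    (∀ y : V, nbr (Fin.snoc x ((α ^ k) (α y))) = α (nbr (Fin.snoc x ((α ^ k) y)))) ∧
    (∀ (a : ZMod 2) (y : V), y ∈ gr a → nbr (Fin.snoc x ((α ^ k) y)) ∈ gr (a + ∑ i, dx i)) ∧
    (∀ (dy : Fin (p + 2) → ZMod 2) (y : Fin (p + 2) → V), (∀ i, y i ∈ gr (dy i)) →
      nbr (Fin.snoc x ((α ^ k) (nbr y))) =
        ∑ i : Fin (p + 2), sgn K ((∑ j, dx j) * partSum dy i) •
          nbr (Function.update (fun j => (α ^ (k + 1)) (y j)) i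
            (nbr (Fin.snoc x ((α ^ k) (y i)))))) := by
  refine ⟨fun y => ?_, fun a y hy => ?_, fun dy y hy => ?_⟩
  · rw [hN.mult, ← Module.End.mul_apply, ← pow_succ, pow_succ', Module.End.mul_apply]
    congr 1
    funext i
    refine Fin.lastCases ?_ (fun j => ?_) i
    · simp
    · simp [hfix]
  · have hmem : ∀ i, (Fin.snoc x ((α ^ k) y) : Fin (p + 2) → V) i ∈
        gr ((Fin.snoc dx a : Fin (p + 2) → ZMod 2) i) := by
      refine Fin.lastCases ?_ (fun j => ?_)
      · simpa using hN.pow_mem k hy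
      · simpa using hx j
    have h := hN.even _ _ hmem
    rwa [Fin.sum_snoc, add_comm] at h
  · have h := hN.nambu dx x dy (fun i => (α ^ k) (y i)) hx fun i => hN.pow_mem k (hy i)
    simp only [hfix, ← Module.End.mul_apply, ← pow_succ'] at h
    rw [hN.pow_nbr]
    exact h

end NHomSuper
end

section
/- Let (g,[·,·],α) be a multiplicative Hom-Lie superalgebra over a field K of characteristic zero, let n ≥ 2, and define the n-linear bracket [x₁,…,xₙ]ₙ = [[…[[x₁,x₂],α(x₃)],α²(x₄)],…,α^{n−2}(xₙ)] (so [x₁,x₂]₂ = [x₁,x₂] and [x₁,…,xₘ]ₘ = [[x₁,…,x_{m−1}]_{m−1}, α^{m−2}(xₘ)] for m ≥ 3). Then for all homogeneous x and all homogeneous y₁,…,yₙ: [α^{n−1}(x), [y₁,…,yₙ]ₙ] = Σ_{k=1}^{n} (−1)^{|x|(|y₁|+⋯+|y_{k−1}|)} [α(y₁),…,α(y_{k−1}),[x,yₖ],α(y_{k+1}),…,α(yₙ)]ₙ. -/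
namespace NHomSuper

variable {K : Type*} [Field K] [CharZero K]
variable {V : Type*} [AddCommGroup V] [Module K V]

theorem partSum_castSucc {n : ℕ} (d : Fin (n + 1) → ZMod 2) (i : Fin n) :
    partSum d i.castSucc = partSum (Fin.init d) i := by
  simp [partSum, Finset.sum_filter, Fin.sum_univ_castSucc, Fin.init, (Fin.le_last _).not_gt]

theorem partSum_last {n : ℕ} (d : Fin (n + 1) → ZMod 2) :
    partSum d (Fin.last n) = ∑ i, Fin.init d i := by
  simp [partSum, Finset.sum_filter, Fin.sum_univ_castSucc, Fin.init]

theorem IsHomLieSuper.leibniz {gr : ZMod 2 → Submodule K V} {br : V →ₗ[K] V →ₗ[K] V}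
    {α : Module.End K V} (hg : IsHomLieSuper gr br α) {a b c : ZMod 2} {x y z : V}
    (hx : x ∈ gr a) (hy : y ∈ gr b) (hz : z ∈ gr c) :
    br (α x) (br y z) = br (br x y) (α z) + sgn K (a * b) • br (α y) (br x z) := by
  have h := hg.jacobi a b c x y z hx hy hz
  rw [hg.skew c a z x hz hx, hg.skew c (a + b) (α z) (br x y) (hg.alpha_even c z hz)
    (hg.br_even a b x y hx hy), map_smul] at h
  have key : ∀ d : ZMod 2, d = 0 ∨ d = 1 := by decide
  have h0 : sgn K 0 = 1 := by simp [sgn]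
  have h1 : sgn K 1 = -1 := by simp [sgn, ZMod.val_one]
  have h11 : (1 + 1 : ZMod 2) = 0 := rfl
  rcases key a with rfl | rfl <;> rcases key b with rfl | rfl <;> rcases key c with rfl | rfl <;>
    simp only [mul_zero, mul_one, add_zero, zero_add, h11, h0, h1] at h ⊢ <;>
    first
    | linear_combination (norm := module) (1 : K) • h
    | linear_combination (norm := module) (-1 : K) • h

theorem IsHomLieSuper.pow_mem {gr : ZMod 2 → Submodule K V} {br : V →ₗ[K] V →ₗ[K] V}
    {α : Module.End K V} (hg : IsHomLieSuper gr br α) {a : ZMod 2} {x : V} (hx : x ∈ gr a)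
    (k : ℕ) : (α ^ k) x ∈ gr a := by
  induction k with
  | zero => simpa using hx
  | succ k ih =>
    rw [pow_succ', Module.End.mul_apply]
    exact hg.alpha_even _ _ ih

theorem IsHomLieSuper.nBr_mem {gr : ZMod 2 → Submodule K V} {br : V →ₗ[K] V →ₗ[K] V}
    {α : Module.End K V} (hg : IsHomLieSuper gr br α) (p : ℕ) {d : Fin (p + 2) → ZMod 2}
    {y : Fin (p + 2) → V} (hy : ∀ i, y i ∈ gr (d i)) : nBr br α p y ∈ gr (∑ i, d i) := by
  induction p with
  | zero =>
    rw [Fin.sum_univ_two]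
    exact hg.br_even _ _ _ _ (hy 0) (hy 1)
  | succ p ih =>
    rw [Fin.sum_univ_castSucc]
    exact hg.br_even _ _ _ _ (ih fun i => hy i.castSucc) (hg.pow_mem (hy _) _)

theorem pow_map_br {br : V →ₗ[K] V →ₗ[K] V} {α : Module.End K V}
    (hmult : ∀ u v : V, α (br u v) = br (α u) (α v)) (k : ℕ) (u v : V) :
    (α ^ k) (br u v) = br ((α ^ k) u) ((α ^ k) v) := by
  induction k with
  | zero => simp
  | succ k ih => simp only [pow_succ', Module.End.mul_apply, ih, hmult]

theorem pow_apply_comm (α : Module.End K V) (k : ℕ) (v : V) :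
    (α ^ k) (α v) = α ((α ^ k) v) :=
  LinearMap.congr_fun (pow_mul_comm' α k) v

theorem map_nBr {br : V →ₗ[K] V →ₗ[K] V} {α : Module.End K V}
    (hmult : ∀ u v : V, α (br u v) = br (α u) (α v)) (p : ℕ) (y : Fin (p + 2) → V) :
    α (nBr br α p y) = nBr br α p fun i => α (y i) := by
  induction p with
  | zero => exact hmult _ _
  | succ p ih =>
    rw [nBr, hmult, ih, ← pow_apply_comm]
    rfl

theorem stmt7 (p : ℕ) (gr : ZMod 2 → Submodule K V) (br : V →ₗ[K] V →ₗ[K] V)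
    (α : Module.End K V) (hg : IsHomLieSuper gr br α)
    (hmult : ∀ u v : V, α (br u v) = br (α u) (α v))
    (a : ZMod 2) (x : V) (hx : x ∈ gr a)
    (dy : Fin (p + 2) → ZMod 2) (y : Fin (p + 2) → V) (hy : ∀ i, y i ∈ gr (dy i)) :
    br ((α ^ (p + 1)) x) (nBr br α p y) =
      ∑ i : Fin (p + 2), sgn K (a * partSum dy i) •
        nBr br α p (Function.update (fun j => α (y j)) i (br x (y i))) := by
  induction p with
  | zero =>
    have h0 : partSum dy 0 = 0 := by simp [partSum]
    have h1 : partSum dy 1 = dy 0 := by simp [partSum, Finset.sum_filter]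
    have hs : sgn K 0 = 1 := by simp [sgn]
    simp [Fin.sum_univ_two, nBr, h0, h1, hs, hg.leibniz hx (hy 0) (hy 1)]
  | succ p ih =>
    have hinit (i : Fin (p + 2)) : Fin.init y i ∈ gr (Fin.init dy i) := hy i.castSucc
    have hlast := hg.pow_mem (hy (Fin.last (p + 2))) (p + 1)
    rw [Fin.sum_univ_castSucc, nBr, pow_succ' α (p + 1), Module.End.mul_apply,
      hg.leibniz (hg.pow_mem hx _) (hg.nBr_mem p hinit) hlast, ih _ _ hinit,
      map_nBr hmult, ← pow_map_br hmult, map_sum, LinearMap.sum_apply, partSum_last]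
    congr 1
    · refine Finset.sum_congr rfl fun i _ => ?_
      rw [nBr, Fin.init_update_castSucc, partSum_castSucc,
        Function.update_of_ne (Fin.castSucc_lt_last i).ne', map_smul, LinearMap.smul_apply,
        ← pow_apply_comm]
      rfl
    · rw [nBr, Fin.init_update_last, Function.update_self]
      rfl

end NHomSuper
end
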